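/- For each integer k ≥ 0, the set of P-positions of the game W_k is {(i,i) : 0 ≤ i < k} ∪ {(A_n + k, B_n + k) : n ≥ 0} ∪ {(B_n + k, A_n + k) : n ≥ 0}. -/

import Mathlib

noncomputable def phi : ℝ := (1 + Real.sqrt 5) / 2
noncomputable def wA (n : ℕ) : ℕ := ⌊phi * n⌋₊
noncomputable def wB (n : ℕ) : ℕ := ⌊phi ^ 2 * n⌋₊

/-- A legal move in the game `W_k` from `p` to `q`: a Nim move, or a diagonal move
whose resulting smaller entry is at least `k`. -/
def WkMove (k : ℕ) (p q : ℕ × ℕ) : Prop :=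
  (∃ t, 1 ≤ t ∧ t ≤ p.1 ∧ q = (p.1 - t, p.2)) ∨
  (∃ t, 1 ≤ t ∧ t ≤ p.2 ∧ q = (p.1, p.2 - t)) ∨
  (∃ s, 1 ≤ s ∧ s ≤ min p.1 p.2 ∧ k ≤ min (p.1 - s) (p.2 - s) ∧ q = (p.1 - s, p.2 - s))

/-- `S` is the set of P-positions of the game with move relation `move`. -/
def IsPPositions (move : ℕ × ℕ → ℕ × ℕ → Prop) (S : Set (ℕ × ℕ)) : Prop :=
  (∀ p ∈ S, ∀ q ∈ S, ¬ move p q) ∧ (∀ p ∉ S, ∃ q ∈ S, move p q)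

/-- `G` is the Sprague–Grundy function of the game with move relation `move`:
at every position, `G` takes the mex of the values of the options. -/
def IsGrundy (move : ℕ × ℕ → ℕ × ℕ → Prop) (G : ℕ × ℕ → ℕ) : Prop :=
  ∀ p, (∀ q, move p q → G q ≠ G p) ∧ (∀ v, v < G p → ∃ q, move p q ∧ G q = v)

lemma phi_eq_goldenRatio : phi = Real.goldenRatio := rfl

lemma wB_eq_wA_add (n : ℕ) : wB n = wA n + n := by
  have h : phi ^ 2 * n = phi * n + n := by
    rw [phi_eq_goldenRatio, Real.goldenRatio_sq]
    ring
  have h0 : 0 ≤ phi * n := mul_nonneg Real.goldenRatio_pos.le n.cast_nonneg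
  rw [wB, wA, h, Nat.floor_add_natCast h0]

lemma wA_strictMono : StrictMono wA := by
  refine strictMono_nat_of_lt_succ fun n => ?_
  have h0 : 0 ≤ phi * n := mul_nonneg Real.goldenRatio_pos.le n.cast_nonneg
  rw [wA, wA, ← Nat.succ_le_iff, Nat.succ_eq_add_one, ← Nat.floor_add_one h0]
  refine Nat.floor_mono ?_
  have h1 : 1 < phi := Real.one_lt_goldenRatio
  push_cast
  linarith

lemma wB_strictMono : StrictMono wB := fun m n h => by
  rw [wB_eq_wA_add, wB_eq_wA_add]
  exact add_lt_add (wA_strictMono h) h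

lemma wA_zero : wA 0 = 0 := by simp [wA]

lemma wB_zero : wB 0 = 0 := by simp [wB]

lemma holderConjugate_phi : (phi ^ 2).HolderConjugate phi := by
  have h1 : 1 < phi := Real.one_lt_goldenRatio
  have h2 : phi ^ 2 = phi + 1 := Real.goldenRatio_sq
  refine Real.HolderConjugate.symm (Real.holderConjugate_iff.2 ⟨h1, ?_⟩)
  field_simp
  linarith

lemma natCast_mem_beattySeq_pos_iff {r : ℝ} (hr : 0 ≤ r) (m : ℕ) :
    (m : ℤ) ∈ {x | ∃ j : ℤ, j > 0 ∧ beattySeq r j = x} ↔ ∃ n : ℕ, 0 < n ∧ ⌊r * n⌋₊ = m := by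
  have key (n : ℕ) : beattySeq r n = (⌊r * n⌋₊ : ℤ) := by
    rw [beattySeq, Int.natCast_floor_eq_floor (by positivity), mul_comm]
    simp
  constructor
  · rintro ⟨j, hj, h⟩
    lift j to ℕ using hj.le
    rw [key] at h
    exact ⟨j, by exact_mod_cast hj, by exact_mod_cast h⟩
  · rintro ⟨n, hn, h⟩
    exact ⟨n, by exact_mod_cast hn, by rw [key, h]⟩

/-- The positive terms of the two Wythoff sequences partition the positive integers. -/
lemma xor_wA_wB {m : ℕ} (hm : 0 < m) :
    Xor (∃ n, 0 < n ∧ wA n = m) (∃ n, 0 < n ∧ wB n = m) := by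
  have hirr : Irrational phi := Real.goldenRatio_irrational
  have hpos : 0 ≤ phi := Real.goldenRatio_pos.le
  have h := hirr.beattySeq_symmDiff_beattySeq_pos holderConjugate_phi.symm
  have hmem : (m : ℤ) ∈ {n : ℤ | 0 < n} := by
    change (0 : ℤ) < m
    exact_mod_cast hm
  rw [← h, Set.mem_symmDiff, natCast_mem_beattySeq_pos_iff hpos,
    natCast_mem_beattySeq_pos_iff (by positivity)] at hmem
  exact hmem

lemma exists_wA_or_wB (m : ℕ) : (∃ n, wA n = m) ∨ ∃ n, wB n = m := by
  rcases m.eq_zero_or_pos with rfl | hm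
  · exact Or.inl ⟨0, wA_zero⟩
  · rcases xor_wA_wB hm with ⟨⟨n, -, h⟩, -⟩ | ⟨⟨n, -, h⟩, -⟩
    exacts [Or.inl ⟨n, h⟩, Or.inr ⟨n, h⟩]

lemma eq_zero_of_wA_eq_wB {m n : ℕ} (h : wA m = wB n) : m = 0 ∧ n = 0 := by
  have hm := wA_strictMono.le_apply (x := m)
  have hn := wB_strictMono.le_apply (x := n)
  by_cases h0 : wA m = 0
  · omega
  · have hm0 : 0 < m := Nat.pos_of_ne_zero fun h' => h0 (h' ▸ wA_zero)
    have hn0 : 0 < n := Nat.pos_of_ne_zero fun h' => h0 (h.trans (h' ▸ wB_zero))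
    rcases xor_wA_wB (Nat.pos_of_ne_zero h0) with ⟨-, h'⟩ | ⟨-, h'⟩
    exacts [(h' ⟨n, hn0, h.symm⟩).elim, (h' ⟨m, hm0, rfl⟩).elim]

/-- `(a, b)` is a P-position of Wythoff's game. -/
def IsWythoffPair (a b : ℕ) : Prop :=
  (∃ n, a = wA n ∧ b = wB n) ∨ ∃ n, a = wB n ∧ b = wA n

namespace IsWythoffPair

lemma symm {a b : ℕ} (h : IsWythoffPair a b) : IsWythoffPair b a := by
  rcases h with ⟨n, ha, hb⟩ | ⟨n, ha, hb⟩
  exacts [Or.inr ⟨n, hb, ha⟩, Or.inl ⟨n, hb, ha⟩]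

lemma right_unique {a b c : ℕ} (hb : IsWythoffPair a b) (hc : IsWythoffPair a c) : b = c := by
  rcases hb with ⟨m, rfl, rfl⟩ | ⟨m, rfl, rfl⟩ <;> rcases hc with ⟨n, h, rfl⟩ | ⟨n, h, rfl⟩
  · rw [wA_strictMono.injective h]
  · obtain ⟨rfl, rfl⟩ := eq_zero_of_wA_eq_wB h
    rw [wA_zero, wB_zero]
  · obtain ⟨rfl, rfl⟩ := eq_zero_of_wA_eq_wB h.symm
    rw [wA_zero, wB_zero]
  · rw [wB_strictMono.injective h]

lemma eq_zero_of_add {a b s : ℕ} (h : IsWythoffPair a b) (hs : IsWythoffPair (a + s) (b + s)) :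
    s = 0 := by
  rcases h with ⟨m, rfl, rfl⟩ | ⟨m, rfl, rfl⟩ <;> rcases hs with ⟨n, h, h'⟩ | ⟨n, h, h'⟩ <;>
    have hm := wB_eq_wA_add m <;> have hn := wB_eq_wA_add n <;>
    obtain rfl : m = n := by omega
  all_goals omega

lemma exists_of_le {a b : ℕ} (hab : a ≤ b) (h : ¬ IsWythoffPair a b) :
    (∃ c < b, IsWythoffPair a c) ∨
      ∃ s, 1 ≤ s ∧ s ≤ a ∧ IsWythoffPair (a - s) (b - s) := by
  rcases exists_wA_or_wB a with ⟨n, rfl⟩ | ⟨n, rfl⟩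
  · rcases lt_trichotomy (wB n) b with hb | rfl | hb
    · exact Or.inl ⟨_, hb, Or.inl ⟨n, rfl, rfl⟩⟩
    · exact (h (Or.inl ⟨n, rfl, rfl⟩)).elim
    · rw [wB_eq_wA_add] at hb
      obtain ⟨d, rfl⟩ := Nat.exists_eq_add_of_le hab
      have hd : wA d < wA n := wA_strictMono (by omega)
      refine Or.inr ⟨wA n - wA d, by omega, by omega, Or.inl ⟨d, by omega, ?_⟩⟩
      rw [wB_eq_wA_add]
      omega
  · have hn := wB_eq_wA_add n
    rcases (show wA n ≤ b by omega).lt_or_eq with hb | rfl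
    · exact Or.inl ⟨_, hb, Or.inr ⟨n, rfl, rfl⟩⟩
    · exact (h (Or.inr ⟨n, rfl, rfl⟩)).elim

end IsWythoffPair

/-- `(a, b)` belongs to the claimed set of P-positions of `W_k`. -/
def IsWkPair (k a b : ℕ) : Prop :=
  (a = b ∧ a < k) ∨ (k ≤ a ∧ k ≤ b ∧ IsWythoffPair (a - k) (b - k))

namespace IsWkPair

variable {k a b : ℕ}

lemma symm (h : IsWkPair k a b) : IsWkPair k b a := by
  rcases h with ⟨rfl, h⟩ | ⟨ha, hb, h⟩
  exacts [Or.inl ⟨rfl, h⟩, Or.inr ⟨hb, ha, h.symm⟩]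

lemma right_unique {c : ℕ} (hb : IsWkPair k a b) (hc : IsWkPair k a c) : b = c := by
  rcases hb with ⟨rfl, h⟩ | ⟨h₁, h₂, h⟩ <;> rcases hc with ⟨rfl, h'⟩ | ⟨h₁', h₂', h'⟩
  · rfl
  · omega
  · omega
  · have := h.right_unique h'
    omega

lemma not_move {p q : ℕ × ℕ} (hp : IsWkPair k p.1 p.2) (hq : IsWkPair k q.1 q.2) :
    ¬ WkMove k p q := by
  obtain ⟨a, b⟩ := p
  rintro (⟨t, ht, hta, rfl⟩ | ⟨t, ht, htb, rfl⟩ | ⟨s, hs, hsab, hk, rfl⟩)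
  · have := hp.symm.right_unique hq.symm
    simp only at *
    omega
  · have := hp.right_unique hq
    simp only at *
    omega
  · simp only at *
    rcases hq with ⟨-, hq⟩ | ⟨-, -, hq⟩
    · omega
    · rcases hp with ⟨-, hp⟩ | ⟨-, -, hp⟩
      · omega
      · have ha : a - k = a - s - k + s := by omega
        have hb : b - k = b - s - k + s := by omega
        rw [ha, hb] at hp
        have := hq.eq_zero_of_add hp
        omega

lemma exists_move_of_le (hab : a ≤ b) (h : ¬ IsWkPair k a b) :
    ∃ q : ℕ × ℕ, IsWkPair k q.1 q.2 ∧ WkMove k (a, b) q := by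
  rcases lt_or_ge a k with hak | hak
  · have hne : a ≠ b := fun he => h (Or.inl ⟨he, hak⟩)
    refine ⟨(a, a), Or.inl ⟨rfl, hak⟩, Or.inr (Or.inl ⟨b - a, by omega, ?_, ?_⟩)⟩
    · exact Nat.sub_le b a
    · rw [Prod.mk.injEq]
      omega
  · have hW : ¬ IsWythoffPair (a - k) (b - k) := fun hW => h (Or.inr ⟨hak, hak.trans hab, hW⟩)
    rcases IsWythoffPair.exists_of_le (Nat.sub_le_sub_right hab k) hW with
      ⟨c, hc, hW'⟩ | ⟨s, hs, hsa, hW'⟩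
    · refine ⟨(a, c + k), Or.inr ⟨hak, Nat.le_add_left k c, by simpa using hW'⟩,
        Or.inr (Or.inl ⟨b - (c + k), by omega, Nat.sub_le _ _, ?_⟩)⟩
      rw [Prod.mk.injEq]
      omega
    · refine ⟨(a - s, b - s), Or.inr ⟨by dsimp only; omega, by dsimp only; omega, ?_⟩,
        Or.inr (Or.inr ⟨s, hs, by dsimp only; omega, by dsimp only; omega, rfl⟩)⟩
      rwa [Nat.sub_right_comm, Nat.sub_right_comm b]

end IsWkPair

lemma WkMove.swap {k : ℕ} {p q : ℕ × ℕ} (h : WkMove k p q) : WkMove k p.swap q.swap := by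
  rcases h with ⟨t, ht, hp, rfl⟩ | ⟨t, ht, hp, rfl⟩ | ⟨s, hs, hp, hk, rfl⟩
  · exact Or.inr (Or.inl ⟨t, ht, hp, rfl⟩)
  · exact Or.inl ⟨t, ht, hp, rfl⟩
  · exact Or.inr (Or.inr ⟨s, hs, by rwa [min_comm] at hp, by rwa [min_comm] at hk, rfl⟩)

lemma WkMove.add_lt_add {k : ℕ} {p q : ℕ × ℕ} (h : WkMove k p q) : q.1 + q.2 < p.1 + p.2 := by
  rcases h with ⟨t, ht, hp, rfl⟩ | ⟨t, ht, hp, rfl⟩ | ⟨s, hs, hp, hk, rfl⟩ <;> dsimp only <;> omega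

lemma isPPositions_isWkPair (k : ℕ) :
    IsPPositions (WkMove k) {p | IsWkPair k p.1 p.2} := by
  refine ⟨fun p hp q hq => IsWkPair.not_move hp hq, fun ⟨a, b⟩ hp => ?_⟩
  rcases le_total a b with hab | hab
  · exact IsWkPair.exists_move_of_le hab hp
  · obtain ⟨q, hq, hm⟩ := IsWkPair.exists_move_of_le hab fun h => hp h.symm
    exact ⟨q.swap, hq.symm, hm.swap⟩

/-- A game in which a natural number decreases along moves has at most one set of P-positions. -/
lemma IsPPositions.eq {move : ℕ × ℕ → ℕ × ℕ → Prop} {S T : Set (ℕ × ℕ)} (f : ℕ × ℕ → ℕ)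
    (hf : ∀ p q, move p q → f q < f p) (hS : IsPPositions move S) (hT : IsPPositions move T) :
    S = T := by
  ext p
  induction hn : f p using Nat.strong_induction_on generalizing p with
  | _ n ih =>
    subst hn
    constructor <;> intro hp <;> by_contra hp'
    · obtain ⟨q, hq, hm⟩ := hT.2 p hp'
      exact hS.1 p hp q ((ih _ (hf p q hm) q rfl).2 hq) hm
    · obtain ⟨q, hq, hm⟩ := hS.2 p hp'
      exact hT.1 p hp q ((ih _ (hf p q hm) q rfl).1 hq) hm

lemma setOf_isWkPair (k : ℕ) :
    {p : ℕ × ℕ | IsWkPair k p.1 p.2} =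
      {p : ℕ × ℕ | ∃ i, i < k ∧ p = (i, i)} ∪
          {p : ℕ × ℕ | ∃ n, p = (wA n + k, wB n + k)} ∪
          {p : ℕ × ℕ | ∃ n, p = (wB n + k, wA n + k)} := by
  ext ⟨a, b⟩
  constructor
  · rintro (⟨h, hk⟩ | ⟨ha, hb, ⟨n, h₁, h₂⟩ | ⟨n, h₁, h₂⟩⟩) <;> dsimp only at *
    · exact Or.inl (Or.inl ⟨a, hk, by rw [h]⟩)
    · exact Or.inl (Or.inr ⟨n, by rw [Prod.mk.injEq]; omega⟩)
    · exact Or.inr ⟨n, by rw [Prod.mk.injEq]; omega⟩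
  · rintro ((⟨i, hi, h⟩ | ⟨n, h⟩) | ⟨n, h⟩) <;> obtain ⟨rfl, rfl⟩ := Prod.mk.inj h
    · exact Or.inl ⟨rfl, hi⟩
    · exact Or.inr ⟨Nat.le_add_left _ _, Nat.le_add_left _ _, Or.inl ⟨n, by simp⟩⟩
    · exact Or.inr ⟨Nat.le_add_left _ _, Nat.le_add_left _ _, Or.inr ⟨n, by simp⟩⟩

theorem Wk_P_positions (k : ℕ) (S : Set (ℕ × ℕ)) :
    IsPPositions (WkMove k) S ↔
      S = {p : ℕ × ℕ | ∃ i, i < k ∧ p = (i, i)} ∪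
          {p : ℕ × ℕ | ∃ n, p = (wA n + k, wB n + k)} ∪
          {p : ℕ × ℕ | ∃ n, p = (wB n + k, wA n + k)} := by
  rw [← setOf_isWkPair]
  constructor
  · intro h
    exact h.eq (fun p => p.1 + p.2) (fun _ _ => WkMove.add_lt_add) (isPPositions_isWkPair k)
  · rintro rfl
    exact isPPositions_isWkPair k
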